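/- Let (P_t) be a tracially symmetric quantum Markov semigroup on M_n(ℂ) whose generator has the Lindblad form L = ∑_{j=1}^d ∂_j†∂_j, let Λ be an operator mean, and let K ∈ ℝ, N ∈ (0,∞]. Assume that for every invertible density matrix ρ the map t ↦ \widehat{P_tρ} = Λ(L(P_tρ), R(P_tρ)) (an operator on the Hilbert space (M_n(ℂ),⟨·,·⟩)) is differentiable at t = 0. Then (P_t) satisfies the gradient estimate GE(K,N) if and only if for every invertible density matrix ρ and every a ∈ M_n(ℂ): Re(∑_{j=1}^d ⟨ρ̂(∂_j L a), ∂_j a⟩) + ½·(d/dt)|_{t=0} ∑_{j=1}^d ⟨\widehat{P_tρ}(∂_j a), ∂_j a⟩ ≥ K·‖∂a‖²_ρ + (1/N)·|E(a,ρ)|². -/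

import Mathlib

open Matrix Filter
open scoped ComplexOrder ENNReal Kronecker

namespace CD

abbrev Mat (ι : Type*) := Matrix ι ι ℂ

variable {ι : Type*}

noncomputable def trn [Fintype ι] (x : Mat ι) : ℂ :=
  (Fintype.card ι : ℂ)⁻¹ * x.trace

noncomputable def inn [Fintype ι] (x y : Mat ι) : ℂ := trn (xᴴ * y)

def matLE [Fintype ι] (A B : Mat ι) : Prop := (B - A).PosSemidef

def blockify [Fintype ι] {m : ℕ} (B : Fin m → Fin m → Mat ι) :
    Matrix (Fin m × ι) (Fin m × ι) ℂ :=
  Matrix.of fun p q => B p.1 q.1 p.2 q.2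

def IsCP [Fintype ι] (Φ : Mat ι →ₗ[ℂ] Mat ι) : Prop :=
  ∀ (m : ℕ) (B : Fin m → Fin m → Mat ι),
    (blockify B).PosSemidef → (blockify fun j k => Φ (B j k)).PosSemidef

structure QMS (ι : Type*) [Fintype ι] [DecidableEq ι] where
  P : ℝ → Mat ι →ₗ[ℂ] Mat ι
  gen : Mat ι →ₗ[ℂ] Mat ι
  P_zero : P 0 = LinearMap.id
  P_add : ∀ s t : ℝ, P (s + t) = (P s) ∘ₗ (P t)
  P_cp : ∀ t : ℝ, 0 ≤ t → IsCP (P t)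
  P_unital : ∀ t : ℝ, 0 ≤ t → P t 1 = 1
  P_cont : ∀ (x : Mat ι) (i j : ι), Continuous fun t : ℝ => P t x i j
  P_deriv : ∀ (x : Mat ι) (i j : ι),
    HasDerivAt (fun t : ℝ => P t x i j) (-(gen x i j)) 0

variable [Fintype ι] [DecidableEq ι]

def TraciallySymm (Q : QMS ι) : Prop :=
  ∀ t : ℝ, 0 ≤ t → ∀ x y : Mat ι, trn (Q.P t x * y) = trn (x * Q.P t y)

noncomputable def Gamma (L : Mat ι →ₗ[ℂ] Mat ι) (a b : Mat ι) : Mat ι :=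
  (2:ℂ)⁻¹ • (aᴴ * L b + (L a)ᴴ * b - L (aᴴ * b))

noncomputable def Gamma2 (L : Mat ι →ₗ[ℂ] Mat ι) (a b : Mat ι) : Mat ι :=
  (2:ℂ)⁻¹ • (Gamma L a (L b) + Gamma L (L a) b - L (Gamma L a b))

noncomputable def BE (L : Mat ι →ₗ[ℂ] Mat ι) (K ν : ℝ) : Prop :=
  ∀ a : Mat ι, matLE (K • Gamma L a a + ν • ((L a)ᴴ * (L a))) (Gamma2 L a a)

noncomputable def cK (K t : ℝ) : ℝ :=
  if K = 0 then 2 * t else (1 - Real.exp (-(2 * K * t))) / K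

noncomputable def comm (v x : Mat ι) : Mat ι := v * x - x * v

def LindbladForm (L : Mat ι →ₗ[ℂ] Mat ι) {d : ℕ} (v : Fin d → Mat ι) : Prop :=
  (∀ j, ∃ k, (v j)ᴴ = v k) ∧ ∀ x, L x = ∑ j, comm ((v j)ᴴ) (comm (v j) x)

def Intertwining (Q : QMS ι) {d : ℕ} (v : Fin d → Mat ι) (K : ℝ) : Prop :=
  ∀ t : ℝ, 0 ≤ t → ∀ (j : Fin d) (x : Mat ι),
    comm (v j) (Q.P t x) = Real.exp (-(K * t)) • Q.P t (comm (v j) x)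

def CBE (L : Mat ι →ₗ[ℂ] Mat ι) (K ν : ℝ) : Prop :=
  ∀ (m : ℕ) (x : Fin m → Mat ι),
    (blockify (fun j k => Gamma2 L (x j) (x k)) -
      (K • blockify (fun j k => Gamma L (x j) (x k)) +
       ν • blockify (fun j k => (L (x j))ᴴ * (L (x k))))).PosSemidef

def IsDensity (ρ : Mat ι) : Prop := ρ.PosSemidef ∧ trn ρ = 1

def IsInvDensity (ρ : Mat ι) : Prop := ρ.PosDef ∧ trn ρ = 1

def sliceL {κ : Type*} (x : Mat (ι × κ)) (a b : κ) : Mat ι :=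
  Matrix.of fun i j => x (i, a) (j, b)

def sliceR {κ : Type*} (x : Mat (κ × ι)) (a b : κ) : Mat ι :=
  Matrix.of fun i j => x (a, i) (b, j)

noncomputable def lTensor (Φ : Mat ι →ₗ[ℂ] Mat ι) (κ : Type*) :
    Mat (ι × κ) →ₗ[ℂ] Mat (ι × κ) where
  toFun x := Matrix.of fun p q => Φ (sliceL x p.2 q.2) p.1 q.1
  map_add' x y := by
    ext p q
    have h : sliceL (x + y) p.2 q.2 = sliceL x p.2 q.2 + sliceL y p.2 q.2 := rfl
    simp only [Matrix.of_apply, h, map_add, Matrix.add_apply]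
  map_smul' c x := by
    ext p q
    have h : sliceL (c • x) p.2 q.2 = c • sliceL x p.2 q.2 := rfl
    simp only [Matrix.of_apply, h, _root_.map_smul, Matrix.smul_apply, RingHom.id_apply]

noncomputable def rTensor (Ψ : Mat ι →ₗ[ℂ] Mat ι) (κ : Type*) :
    Mat (κ × ι) →ₗ[ℂ] Mat (κ × ι) where
  toFun x := Matrix.of fun p q => Ψ (sliceR x p.1 q.1) p.2 q.2
  map_add' x y := by
    ext p q
    have h : sliceR (x + y) p.1 q.1 = sliceR x p.1 q.1 + sliceR y p.1 q.1 := rfl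
    simp only [Matrix.of_apply, h, map_add, Matrix.add_apply]
  map_smul' c x := by
    ext p q
    have h : sliceR (c • x) p.1 q.1 = c • sliceR x p.1 q.1 := rfl
    simp only [Matrix.of_apply, h, _root_.map_smul, Matrix.smul_apply, RingHom.id_apply]

end CD

namespace CD

abbrev Op (ι : Type*) := Mat ι →ₗ[ℂ] Mat ι

variable {ι : Type*} [Fintype ι] [DecidableEq ι]

/-- A positive (semidefinite) operator on the Hilbert space `(Mat ι, ⟨·,·⟩)`. -/
def IsPSDop (T : Op ι) : Prop :=
  (∀ x y : Mat ι, inn (T x) y = inn x (T y)) ∧ ∀ x : Mat ι, 0 ≤ inn x (T x)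

def opLE (A B : Op ι) : Prop := IsPSDop (B - A)

/-- An operator mean on the Hilbert space `(Mat ι, ⟨·,·⟩)`: monotone, satisfying the
transformer inequality, continuous along decreasing sequences, and normalized. -/
structure OperatorMean (ι : Type*) [Fintype ι] [DecidableEq ι] where
  mean : Op ι → Op ι → Op ι
  psd : ∀ A B : Op ι, IsPSDop A → IsPSDop B → IsPSDop (mean A B)
  mono : ∀ A B C D : Op ι, IsPSDop A → IsPSDop B → IsPSDop C → IsPSDop D →
    opLE A C → opLE B D → opLE (mean A B) (mean C D)
  transformer : ∀ A B C : Op ι, IsPSDop A → IsPSDop B → IsPSDop C →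
    opLE (C ∘ₗ mean A B ∘ₗ C) (mean (C ∘ₗ A ∘ₗ C) (C ∘ₗ B ∘ₗ C))
  contDecr : ∀ (A B : ℕ → Op ι) (A' B' : Op ι),
    (∀ k, IsPSDop (A k)) → (∀ k, IsPSDop (B k)) →
    (∀ k, opLE (A (k+1)) (A k)) → (∀ k, opLE (B (k+1)) (B k)) →
    (∀ (x : Mat ι) (i j : ι),
      Filter.Tendsto (fun k => A k x i j) Filter.atTop (nhds (A' x i j))) →
    (∀ (x : Mat ι) (i j : ι),
      Filter.Tendsto (fun k => B k x i j) Filter.atTop (nhds (B' x i j))) →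
    ∀ (x : Mat ι) (i j : ι),
      Filter.Tendsto (fun k => mean (A k) (B k) x i j) Filter.atTop
        (nhds (mean A' B' x i j))
  mean_id : mean LinearMap.id LinearMap.id = LinearMap.id

/-- `ρ̂ = Λ(L(ρ), R(ρ))`, the operator mean of left and right multiplication by `ρ`. -/
noncomputable def rhoHat (M : OperatorMean ι) (ρ : Mat ι) : Op ι :=
  M.mean (LinearMap.mulLeft ℂ ρ) (LinearMap.mulRight ℂ ρ)

/-- `‖∂a‖²_ρ = ∑ⱼ ⟨ρ̂(∂ⱼa), ∂ⱼa⟩`, for derivations `∂ⱼ = [vⱼ, ·]`. -/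
noncomputable def dNormSq {J : Type*} [Fintype J] (M : OperatorMean ι)
    (v : J → Mat ι) (ρ a : Mat ι) : ℝ :=
  ∑ j, (inn (rhoHat M ρ (comm (v j) a)) (comm (v j) a)).re

/-- The gradient estimate `GE(K,N)` (`ν` plays the role of `1/N`) for a semigroup `P`
with generator `L`, derivations `∂ⱼ = [vⱼ, ·]` and operator mean `M`. -/
noncomputable def GE' {J : Type*} [Fintype J] (P : ℝ → Op ι) (L : Op ι)
    (v : J → Mat ι) (M : OperatorMean ι) (K ν : ℝ) : Prop :=
  ∀ t : ℝ, 0 ≤ t → ∀ a ρ : Mat ι, ρ.PosDef → trn ρ = 1 →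
    dNormSq M v ρ (P t a) ≤
      Real.exp (-(2 * K * t)) * dNormSq M v (P t ρ) a -
        ν * cK K t * Complex.normSq (inn a (L (P t ρ)))

end CD

namespace CD

section Inner

variable {ι : Type*} [Fintype ι]

lemma trn_mul_comm (x y : Mat ι) : trn (x * y) = trn (y * x) := by
  rw [trn, trn, Matrix.trace_mul_comm]

lemma trn_nonneg {x : Mat ι} (hx : x.PosSemidef) : 0 ≤ trn x := by
  have h : (0 : ℂ) ≤ (Fintype.card ι : ℂ)⁻¹ := by
    rw [← Complex.ofReal_natCast, ← Complex.ofReal_inv, Complex.zero_le_real]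
    positivity
  exact mul_nonneg h hx.trace_nonneg

lemma inn_add_left (x y z : Mat ι) : inn (x + y) z = inn x z + inn y z := by
  simp [inn, trn, add_mul, mul_add]

lemma inn_add_right (x y z : Mat ι) : inn x (y + z) = inn x y + inn x z := by
  simp [inn, trn, mul_add]

lemma inn_smul_left (c : ℂ) (x y : Mat ι) : inn (c • x) y = star c * inn x y := by
  simp [inn, trn, mul_left_comm]

lemma inn_smul_right (c : ℂ) (x y : Mat ι) : inn x (c • y) = c * inn x y := by
  simp [inn, trn, mul_left_comm]

lemma inn_neg_left (x y : Mat ι) : inn (-x) y = -inn x y := by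
  simp [inn, trn]

lemma inn_sub_left (x y z : Mat ι) : inn (x - y) z = inn x z - inn y z := by
  rw [sub_eq_add_neg, inn_add_left, inn_neg_left, ← sub_eq_add_neg]

lemma star_inn (x y : Mat ι) : star (inn x y) = inn y x := by
  simp only [inn, trn, star_mul', star_inv₀, star_natCast, ← Matrix.trace_conjTranspose,
    conjTranspose_mul, conjTranspose_conjTranspose]

lemma inn_re_symm (x y : Mat ι) : (inn x y).re = (inn y x).re := by
  rw [← star_inn]; simp

/-- The sesquilinear form `⟨x, ·⟩` as a linear functional. -/
noncomputable def innRight (x : Mat ι) : Mat ι →ₗ[ℂ] ℂ where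
  toFun := inn x
  map_add' := inn_add_right x
  map_smul' c := inn_smul_right c x

lemma inn_sum_right {κ : Type*} (s : Finset κ) (x : Mat ι) (f : κ → Mat ι) :
    inn x (∑ k ∈ s, f k) = ∑ k ∈ s, inn x (f k) :=
  map_sum (innRight x) f s

lemma inn_sum_left {κ : Type*} (s : Finset κ) (f : κ → Mat ι) (y : Mat ι) :
    inn (∑ k ∈ s, f k) y = ∑ k ∈ s, inn (f k) y := by
  rw [← star_inn, inn_sum_right, star_sum]
  simp only [star_inn]

end Inner

section Calculus

variable {ι : Type*} [Fintype ι] [DecidableEq ι]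

lemma eq_sum_smul_single (x : Mat ι) :
    x = ∑ p : ι × ι, x p.1 p.2 • Matrix.single p.1 p.2 (1 : ℂ) := by
  conv_lhs => rw [matrix_eq_sum_single x, ← Fintype.sum_prod_type']
  simp

lemma linear_eq_sum (φ : Mat ι →ₗ[ℂ] ℂ) (x : Mat ι) :
    φ x = ∑ p : ι × ι, x p.1 p.2 * φ (Matrix.single p.1 p.2 1) := by
  conv_lhs => rw [eq_sum_smul_single x]
  simp only [map_sum, _root_.map_smul, smul_eq_mul]

lemma hasDerivAt_linear {x : ℝ → Mat ι} {x' : Mat ι} {s : ℝ}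
    (hx : ∀ i j, HasDerivAt (fun t => x t i j) (x' i j) s) (φ : Mat ι →ₗ[ℂ] ℂ) :
    HasDerivAt (fun t => φ (x t)) (φ x') s := by
  rw [linear_eq_sum φ x', funext fun t => linear_eq_sum φ (x t)]
  exact HasDerivAt.fun_sum fun p _ => (hx p.1 p.2).mul_const _

/-- The `(i, j)` entry of `Φ x`, as a linear functional of `x`. -/
def entryOf (Φ : Op ι) (i j : ι) : Mat ι →ₗ[ℂ] ℂ := (Matrix.entryLinearMap ℂ ℂ i j) ∘ₗ Φ

lemma hasDerivAt_map {x : ℝ → Mat ι} {x' : Mat ι} {s : ℝ}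
    (hx : ∀ i j, HasDerivAt (fun t => x t i j) (x' i j) s) (Φ : Op ι) (i j : ι) :
    HasDerivAt (fun t => Φ (x t) i j) (Φ x' i j) s :=
  hasDerivAt_linear hx (entryOf Φ i j)

lemma inn_apply_eq_sum (T : Op ι) (x y : Mat ι) :
    inn (T x) y = ∑ p : ι × ι, ∑ q : ι × ι, star (x p.1 p.2) * y q.1 q.2 *
      inn (T (Matrix.single p.1 p.2 1)) (Matrix.single q.1 q.2 1) := by
  conv_lhs => rw [eq_sum_smul_single x, eq_sum_smul_single y]
  simp only [map_sum, _root_.map_smul, inn_sum_left, inn_smul_left, inn_sum_right, inn_smul_right,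
    Finset.mul_sum]
  rw [Finset.sum_comm]
  exact Finset.sum_congr rfl fun p _ => Finset.sum_congr rfl fun q _ => by ring

lemma hasDerivWithinAt_inn_apply {T : ℝ → Op ι} {T' : Op ι} {x : ℝ → Mat ι} {x' : Mat ι}
    {S : Set ℝ} {s : ℝ}
    (hT : ∀ a b, HasDerivWithinAt (fun t => inn (T t a) b) (inn (T' a) b) S s)
    (hx : ∀ i j, HasDerivWithinAt (fun t => x t i j) (x' i j) S s) :
    HasDerivWithinAt (fun t => inn (T t (x t)) (x t))
      (inn (T s x') (x s) + inn (T s (x s)) x' + inn (T' (x s)) (x s)) S s := by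
  rw [funext fun t => inn_apply_eq_sum (T t) (x t) (x t), inn_apply_eq_sum (T s) x',
    inn_apply_eq_sum (T s) _ x', inn_apply_eq_sum T', ← Finset.sum_add_distrib,
    ← Finset.sum_add_distrib]
  refine HasDerivWithinAt.fun_sum fun p _ => ?_
  rw [← Finset.sum_add_distrib, ← Finset.sum_add_distrib]
  refine HasDerivWithinAt.fun_sum fun q _ => ?_
  refine (((hx p.1 p.2).star.mul (hx q.1 q.2)).mul (hT _ _)).congr_deriv ?_
  simp only [Pi.mul_apply]
  ring

lemma continuousWithinAt_inn_apply (T : Op ι) {x : ℝ → Mat ι} {S : Set ℝ} {s : ℝ}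
    (hx : ∀ i j, ContinuousWithinAt (fun t => x t i j) S s) :
    ContinuousWithinAt (fun t => inn (T (x t)) (x t)) S s := by
  rw [funext fun t => inn_apply_eq_sum T (x t) (x t)]
  refine tendsto_finsetSum _ fun p _ => tendsto_finsetSum _ fun q _ => ?_
  exact ((hx p.1 p.2).star.mul (hx q.1 q.2)).mul continuousWithinAt_const

end Calculus

section Positivity

lemma smul_posSemidef {ι : Type*} {c : ℝ} (hc : 0 ≤ c) {x : Mat ι} (hx : x.PosSemidef) :
    ((c : ℂ) • x).PosSemidef :=
  hx.smul (Complex.zero_le_real.2 hc)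

variable {ι : Type*} [Fintype ι]

lemma IsCP.map_posSemidef {Φ : Op ι} (hΦ : IsCP Φ) {x : Mat ι} (hx : x.PosSemidef) :
    (Φ x).PosSemidef := by
  have h := hΦ 1 (fun _ _ => x) (hx.submatrix Prod.snd)
  exact h.submatrix (fun i => ((0 : Fin 1), i))

lemma IsCP.map_conjTranspose [DecidableEq ι] {Φ : Op ι} (hΦ : IsCP Φ) (x : Mat ι) : Φ xᴴ = (Φ x)ᴴ := by
  let y : Fin 2 → Mat ι := ![1, x]
  have hB : (blockify fun j k => (y j)ᴴ * y k).PosSemidef := by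
    convert Matrix.posSemidef_conjTranspose_mul_self
      (Matrix.of fun (i : ι) (p : Fin 2 × ι) => y p.1 i p.2) using 1
    ext p q
    simp [blockify, Matrix.mul_apply]
  have h := (hΦ 2 _ hB).isHermitian
  ext i j
  have := congrFun (congrFun h (1, i)) (0, j)
  simpa [blockify, y] using this.symm

lemma isPSDop_mulLeft {x : Mat ι} (hx : x.PosSemidef) : IsPSDop (LinearMap.mulLeft ℂ x) := by
  refine ⟨fun a b => ?_, fun a => ?_⟩
  · simp [inn, conjTranspose_mul, hx.isHermitian.eq, mul_assoc]
  · have := trn_nonneg (hx.conjTranspose_mul_mul_same a)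
    simpa [inn, mul_assoc] using this

lemma isPSDop_mulRight {x : Mat ι} (hx : x.PosSemidef) : IsPSDop (LinearMap.mulRight ℂ x) := by
  refine ⟨fun a b => ?_, fun a => ?_⟩
  · simp only [inn, LinearMap.mulRight_apply, conjTranspose_mul, hx.isHermitian.eq]
    rw [mul_assoc, trn_mul_comm, mul_assoc]
  · have := trn_nonneg (hx.mul_mul_conjTranspose_same a)
    simp only [inn, LinearMap.mulRight_apply]
    rwa [trn_mul_comm]

lemma opLE_mulLeft {x y : Mat ι} (h : matLE x y) :
    opLE (LinearMap.mulLeft ℂ x) (LinearMap.mulLeft ℂ y) := by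
  have e : LinearMap.mulLeft ℂ y - LinearMap.mulLeft ℂ x = LinearMap.mulLeft ℂ (y - x) := by
    ext1 a
    simp [sub_mul]
  rw [opLE, e]
  exact isPSDop_mulLeft h

lemma opLE_mulRight {x y : Mat ι} (h : matLE x y) :
    opLE (LinearMap.mulRight ℂ x) (LinearMap.mulRight ℂ y) := by
  have e : LinearMap.mulRight ℂ y - LinearMap.mulRight ℂ x = LinearMap.mulRight ℂ (y - x) := by
    ext1 a
    simp [mul_sub]
  rw [opLE, e]
  exact isPSDop_mulRight h

lemma opLE.inn_re_le {A B : Op ι} (h : opLE A B) (x : Mat ι) :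
    (inn (A x) x).re ≤ (inn (B x) x).re := by
  have h0 := h.2 x
  rw [← h.1, LinearMap.sub_apply, inn_sub_left] at h0
  simpa using (Complex.le_def.1 h0).1

variable [DecidableEq ι]

lemma rhoHat_isPSDop (M : OperatorMean ι) {x : Mat ι} (hx : x.PosSemidef) :
    IsPSDop (rhoHat M x) :=
  M.psd _ _ (isPSDop_mulLeft hx) (isPSDop_mulRight hx)

lemma rhoHat_mono (M : OperatorMean ι) {x y : Mat ι} (hx : x.PosSemidef) (hy : y.PosSemidef)
    (h : matLE x y) : opLE (rhoHat M x) (rhoHat M y) :=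
  M.mono _ _ _ _ (isPSDop_mulLeft hx) (isPSDop_mulRight hx) (isPSDop_mulLeft hy)
    (isPSDop_mulRight hy) (opLE_mulLeft h) (opLE_mulRight h)

lemma mul_inn_rhoHat_le (M : OperatorMean ι) {c : ℝ} (hc : 0 ≤ c) {x : Mat ι}
    (hx : x.PosSemidef) (a : Mat ι) :
    c * (inn (rhoHat M x a) a).re ≤ (inn (rhoHat M ((c : ℂ) • x) a) a).re := by
  have hC : IsPSDop (((√c : ℝ) : ℂ) • (LinearMap.id : Op ι)) := by
    refine ⟨fun a b => ?_, fun a => ?_⟩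
    · simp only [LinearMap.smul_apply, LinearMap.id_apply, inn_smul_left, inn_smul_right]
      simp
    · have h1 : 0 ≤ inn a a := trn_nonneg (Matrix.posSemidef_conjTranspose_mul_self a)
      rw [LinearMap.smul_apply, inn_smul_right]
      exact mul_nonneg (Complex.zero_le_real.2 (Real.sqrt_nonneg c)) h1
  have hsq : ((√c : ℝ) : ℂ) * ((√c : ℝ) : ℂ) = c := by
    rw [← Complex.ofReal_mul, Real.mul_self_sqrt hc]
  have h := (M.transformer _ _ _ (isPSDop_mulLeft hx) (isPSDop_mulRight hx) hC).inn_re_le a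
  have e1 : (((√c : ℝ) : ℂ) • (LinearMap.id : Op ι)) ∘ₗ LinearMap.mulLeft ℂ x ∘ₗ
      (((√c : ℝ) : ℂ) • (LinearMap.id : Op ι)) = LinearMap.mulLeft ℂ ((c : ℂ) • x) := by
    ext1 b
    simp only [LinearMap.comp_apply, LinearMap.smul_apply, LinearMap.id_apply, smul_smul, hsq,
      LinearMap.mulLeft_apply, smul_mul_assoc, mul_smul_comm]
  have e2 : (((√c : ℝ) : ℂ) • (LinearMap.id : Op ι)) ∘ₗ LinearMap.mulRight ℂ x ∘ₗ
      (((√c : ℝ) : ℂ) • (LinearMap.id : Op ι)) = LinearMap.mulRight ℂ ((c : ℂ) • x) := by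
    ext1 b
    simp only [LinearMap.comp_apply, LinearMap.smul_apply, LinearMap.id_apply, smul_smul, hsq,
      LinearMap.mulRight_apply, smul_mul_assoc, mul_smul_comm]
  rw [e1, e2] at h
  refine le_trans (le_of_eq ?_) h
  simp only [rhoHat, LinearMap.comp_apply, LinearMap.smul_apply, LinearMap.id_apply,
    _root_.map_smul, smul_smul, hsq, inn_smul_left]
  simp

lemma inn_rhoHat_smul (M : OperatorMean ι) {c : ℝ} (hc : 0 < c) {x : Mat ι}
    (hx : x.PosSemidef) (a : Mat ι) :
    (inn (rhoHat M ((c : ℂ) • x) a) a).re = c * (inn (rhoHat M x a) a).re := by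
  refine le_antisymm ?_ (mul_inn_rhoHat_le M hc.le hx a)
  have h := mul_inn_rhoHat_le M (inv_nonneg.2 hc.le) (smul_posSemidef hc.le hx) a
  rw [smul_smul, ← Complex.ofReal_mul, inv_mul_cancel₀ hc.ne', Complex.ofReal_one, one_smul] at h
  rwa [inv_mul_le_iff₀ hc] at h

lemma abs_inn_rhoHat_sub_le (M : OperatorMean ι) {x y : Mat ι} {ε : ℝ} (hε : 0 < ε) (hε' : ε < 1)
    (hx : x.PosSemidef) (hy : y.PosSemidef)
    (h₁ : matLE (((1 - ε : ℝ) : ℂ) • x) y) (h₂ : matLE y (((1 + ε : ℝ) : ℂ) • x)) (a : Mat ι) :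
    |(inn (rhoHat M y a) a).re - (inn (rhoHat M x a) a).re| ≤ ε * (inn (rhoHat M x a) a).re := by
  have hm : 0 < 1 - ε := by linarith
  have hp : 0 < 1 + ε := by linarith
  have l := (rhoHat_mono M (smul_posSemidef hm.le hx) hy h₁).inn_re_le a
  have u := (rhoHat_mono M hy (smul_posSemidef hp.le hx) h₂).inn_re_le a
  rw [inn_rhoHat_smul M hm hx] at l
  rw [inn_rhoHat_smul M hp hx] at u
  rw [abs_le]
  constructor <;> linarith

open scoped MatrixOrder Matrix.Norms.L2Operator in
lemma PosDef.eventually_near {x : Mat ι} (hx : x.PosDef) {ε : ℝ} (hε : 0 < ε) :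
    ∀ᶠ y in nhds x, y.IsHermitian →
      matLE (((1 - ε : ℝ) : ℂ) • x) y ∧ matLE y (((1 + ε : ℝ) : ℂ) • x) := by
  rcases isEmpty_or_nonempty ι with hι | hι
  · refine Eventually.of_forall fun y _ => ⟨?_, ?_⟩ <;>
    · rw [matLE, Subsingleton.elim (_ - _) (0 : Mat ι)]
      exact Matrix.PosSemidef.zero
  obtain ⟨r, hr, hrx⟩ := (CFC.exists_pos_algebraMap_le_iff hx.isHermitian.isSelfAdjoint).2
    fun t ht => hx.isStrictlyPositive.spectrum_pos ht
  filter_upwards [Metric.ball_mem_nhds x (mul_pos hε hr)] with y hy hyh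
  have hn : ‖y - x‖ ≤ ε * r := (mem_ball_iff_norm.1 hy).le
  have hs : IsSelfAdjoint (y - x) := hyh.isSelfAdjoint.sub hx.isHermitian.isSelfAdjoint
  have hmon : algebraMap ℝ (Mat ι) ‖y - x‖ ≤ ((ε : ℝ) : ℂ) • x := by
    calc algebraMap ℝ (Mat ι) ‖y - x‖ ≤ algebraMap ℝ (Mat ι) (ε * r) :=
          algebraMap_mono (Mat ι) hn
      _ = ε • algebraMap ℝ (Mat ι) r := by rw [map_mul, Algebra.smul_def]
      _ ≤ ε • x := smul_le_smul_of_nonneg_left hrx hε.le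
      _ = _ := (Complex.coe_smul ε x).symm
  have u := hs.le_algebraMap_norm_self.trans hmon
  have l := (neg_le_neg hmon).trans hs.neg_algebraMap_norm_le_self
  constructor
  · rw [matLE, ← Matrix.le_iff]
    calc ((1 - ε : ℝ) : ℂ) • x = x + -((ε : ℂ) • x) := by
          push_cast; rw [sub_smul, one_smul, sub_eq_add_neg]
      _ ≤ x + (y - x) := by gcongr
      _ = y := by abel
  · rw [matLE, ← Matrix.le_iff]
    calc y = x + (y - x) := by abel
      _ ≤ x + (ε : ℂ) • x := by gcongr
      _ = _ := by push_cast; rw [add_smul, one_smul]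

/-- Joint continuity of `(ρ, x) ↦ ⟨ρ̂ x, x⟩` along curves of positive semidefinite matrices, at
parameters where the matrix is positive definite. -/
lemma continuousWithinAt_inn_rhoHat (M : OperatorMean ι) {σ x : ℝ → Mat ι} {S : Set ℝ} {s : ℝ}
    (hpos : ∀ t ∈ S, (σ t).PosSemidef) (hdef : (σ s).PosDef)
    (hσ : ∀ i j, ContinuousWithinAt (fun t => σ t i j) S s)
    (hx : ∀ i j, ContinuousWithinAt (fun t => x t i j) S s) :
    ContinuousWithinAt (fun t => (inn (rhoHat M (σ t) (x t)) (x t)).re) S s := by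
  have hσ' : Tendsto σ (nhdsWithin s S) (nhds (σ s)) :=
    tendsto_pi_nhds.2 fun i => tendsto_pi_nhds.2 fun j => hσ i j
  set g : ℝ → ℝ := fun t => (inn (rhoHat M (σ s) (x t)) (x t)).re
  have hg : Tendsto g (nhdsWithin s S) (nhds (g s)) :=
    Complex.continuous_re.continuousAt.comp_continuousWithinAt
      (continuousWithinAt_inn_apply (rhoHat M (σ s)) hx)
  have hdiff : Tendsto (fun t => (inn (rhoHat M (σ t) (x t)) (x t)).re - g t)
      (nhdsWithin s S) (nhds 0) := by
    rw [Metric.tendsto_nhds]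
    intro η hη
    set ε : ℝ := min (1 / 2) (η / (|g s| + 1) / 2)
    have hε : 0 < ε := by positivity
    have hε1 : ε < 1 := (min_le_left _ _).trans_lt (by norm_num)
    have hε2 : ε * (|g s| + 1) < η := by
      have h1 : ε ≤ η / (|g s| + 1) / 2 := min_le_right _ _
      have h2 : η / (|g s| + 1) / 2 < η / (|g s| + 1) := half_lt_self (by positivity)
      rw [← lt_div_iff₀ (by positivity)]
      exact h1.trans_lt h2
    have hbd : ∀ᶠ t in nhdsWithin s S, g t < |g s| + 1 :=
      hg.eventually_lt_const (by linarith [le_abs_self (g s)])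
    filter_upwards [hσ'.eventually (PosDef.eventually_near hdef hε), hbd, self_mem_nhdsWithin]
      with t ht hgt htS
    obtain ⟨h1, h2⟩ := ht (hpos t htS).isHermitian
    have h3 := abs_inn_rhoHat_sub_le M hε hε1 hdef.posSemidef (hpos t htS) h1 h2 (x t)
    rw [Real.dist_eq, sub_zero]
    calc _ ≤ ε * g t := h3
      _ ≤ ε * (|g s| + 1) := by gcongr
      _ < η := hε2
  have := hdiff.add hg
  rw [ContinuousWithinAt]
  simpa using this

end Positivity

section Semigroup

variable {ι : Type*} [Fintype ι] [DecidableEq ι]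

namespace QMS

variable (Q : QMS ι)

lemma P_add_apply (s t : ℝ) (x : Mat ι) : Q.P (s + t) x = Q.P s (Q.P t x) := by
  rw [Q.P_add, LinearMap.comp_apply]

lemma hasDerivAt_P (x : Mat ι) (s : ℝ) (i j : ι) :
    HasDerivAt (fun t => Q.P t x i j) (-(Q.P s (Q.gen x) i j)) s := by
  have h0 : ∀ i j, HasDerivAt (fun t => Q.P (t - s) x i j) ((-Q.gen x) i j) s := fun i j =>
    HasDerivAt.comp_sub_const s s (f := fun t => Q.P t x i j) (by simpa using Q.P_deriv x i j)
  have h := hasDerivAt_map h0 (Q.P s) i j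
  simpa [← Q.P_add_apply] using h

lemma P_gen (s : ℝ) (x : Mat ι) : Q.P s (Q.gen x) = Q.gen (Q.P s x) := by
  ext i j
  have h := Q.P_deriv (Q.P s x) i j
  have h' : HasDerivAt (fun t => Q.P t (Q.P s x) i j) (-(Q.P s (Q.gen x) i j)) 0 := by
    simp only [← Q.P_add_apply]
    exact HasDerivAt.comp_add_const 0 s (f := fun t => Q.P t x i j)
      (by simpa using Q.hasDerivAt_P x s i j)
  exact neg_injective (h'.unique h)

lemma posSemidef_P {t : ℝ} (ht : 0 ≤ t) {x : Mat ι} (hx : x.PosSemidef) :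
    (Q.P t x).PosSemidef :=
  (Q.P_cp t ht).map_posSemidef hx

open scoped MatrixOrder Matrix.Norms.L2Operator in
lemma posDef_P {t : ℝ} (ht : 0 ≤ t) {x : Mat ι} (hx : x.PosDef) : (Q.P t x).PosDef := by
  rcases isEmpty_or_nonempty ι with hι | hι
  · rw [Subsingleton.elim (Q.P t x) x]
    exact hx
  obtain ⟨r, hr, hrx⟩ := (CFC.exists_pos_algebraMap_le_iff hx.isHermitian.isSelfAdjoint).2
    fun t ht => hx.isStrictlyPositive.spectrum_pos ht
  have h1 : (algebraMap ℝ (Mat ι) r) = (r : ℂ) • (1 : Mat ι) := by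
    rw [Algebra.algebraMap_eq_smul_one, Complex.coe_smul]
  rw [h1, Matrix.le_iff] at hrx
  have h2 := Q.posSemidef_P ht hrx
  rw [map_sub, _root_.map_smul, Q.P_unital t ht] at h2
  have h3 : ((r : ℂ) • (1 : Mat ι)).PosDef :=
    Matrix.PosDef.one.smul (Complex.zero_lt_real.2 hr)
  simpa using h3.add_posSemidef h2

variable {Q}

lemma trn_P (hsymm : TraciallySymm Q) {t : ℝ} (ht : 0 ≤ t) (x : Mat ι) :
    trn (Q.P t x) = trn x := by
  simpa [Q.P_unital t ht] using hsymm t ht x 1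

lemma inn_P (hsymm : TraciallySymm Q) {t : ℝ} (ht : 0 ≤ t) (x y : Mat ι) :
    inn (Q.P t x) y = inn x (Q.P t y) := by
  rw [inn, ← (Q.P_cp t ht).map_conjTranspose, hsymm t ht, inn]

end QMS

end Semigroup

section GradientEstimate

variable {ι J : Type*} [Fintype ι] [DecidableEq ι] [Fintype J]

/-- The commutator `[v, ·]` as a linear map. -/
noncomputable def commMap (v : Mat ι) : Op ι := LinearMap.mulLeft ℂ v - LinearMap.mulRight ℂ v

lemma commMap_apply (v x : Mat ι) : commMap v x = comm v x := rfl

lemma comm_neg (v x : Mat ι) : comm v (-x) = -comm v x := map_neg (commMap v) x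

lemma comm_zero (v : Mat ι) : comm v 0 = 0 := map_zero (commMap v)

lemma hasDerivAt_cK (K t : ℝ) :
    HasDerivAt (cK K) (2 * Real.exp (-(2 * K * t))) t := by
  unfold cK
  split_ifs with hK
  · simpa [hK] using (hasDerivAt_id t).const_mul (2 : ℝ)
  · have h := ((((hasDerivAt_id t).const_mul (2 * K)).neg.exp).const_sub 1).div_const K
    refine h.congr_deriv ?_
    simp only [id, Pi.neg_apply]
    field_simp

lemma cK_zero (K : ℝ) : cK K 0 = 0 := by simp [cK]

lemma hasDerivAt_exp_neg (K t : ℝ) :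
    HasDerivAt (fun t => Real.exp (-(2 * K * t))) (-(2 * K) * Real.exp (-(2 * K * t))) t := by
  have h := ((hasDerivAt_id t).const_mul (2 * K)).neg.exp
  exact h.congr_deriv (by simp only [id, Pi.neg_apply]; ring)

/-- Right derivative of `t ↦ ‖∂x_t‖²_{σ_t}`. -/
lemma hasDerivWithinAt_dNormSq (M : OperatorMean ι) (v : J → Mat ι) {σ x : ℝ → Mat ι}
    {x' : Mat ι} {T' : Op ι} {S : Set ℝ} {s : ℝ} (hσ : (σ s).PosSemidef)
    (hT : ∀ a b, HasDerivWithinAt (fun t => inn (rhoHat M (σ t) a) b) (inn (T' a) b) S s)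
    (hx : ∀ i j, HasDerivAt (fun t => x t i j) (x' i j) s) :
    HasDerivWithinAt (fun t => dNormSq M v (σ t) (x t))
      (2 * (∑ j, inn (rhoHat M (σ s) (comm (v j) x')) (comm (v j) (x s))).re +
        (∑ j, inn (T' (comm (v j) (x s))) (comm (v j) (x s))).re) S s := by
  rw [Complex.re_sum, Complex.re_sum, Finset.mul_sum, ← Finset.sum_add_distrib]
  refine HasDerivWithinAt.fun_sum fun j _ => ?_
  have h := hasDerivWithinAt_inn_apply hT
    fun i k => (hasDerivAt_map hx (commMap (v j)) i k).hasDerivWithinAt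
  have h' := Complex.reCLM.hasFDerivAt.comp_hasDerivWithinAt s h
  simp only [commMap_apply] at h'
  refine h'.congr_deriv ?_
  have hs := (rhoHat_isPSDop M hσ).1 (comm (v j) (x s)) (comm (v j) x')
  rw [hs]
  simp only [Complex.reCLM_apply, Complex.add_re]
  rw [inn_re_symm (comm (v j) (x s))]
  ring

lemma continuousOn_dNormSq (M : OperatorMean ι) (v : J → Mat ι) {σ x : ℝ → Mat ι}
    {S : Set ℝ} (hσ : ∀ t ∈ S, (σ t).PosDef)
    (hσc : ∀ i j, ContinuousOn (fun t => σ t i j) S)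
    (hx : ∀ i j, ContinuousOn (fun t => x t i j) S) :
    ContinuousOn (fun t => dNormSq M v (σ t) (x t)) S := by
  intro s hs
  refine tendsto_finsetSum _ fun j _ => ?_
  have hx' : ∀ i k, ContinuousWithinAt (fun t => comm (v j) (x t) i k) S s := by
    intro i k
    have hl : Continuous (entryOf (commMap (v j)) i k) :=
      LinearMap.continuous_of_finiteDimensional _
    exact hl.continuousAt.comp_continuousWithinAt
      (tendsto_pi_nhds.2 fun a => tendsto_pi_nhds.2 fun b => hx a b s hs)
  exact continuousWithinAt_inn_rhoHat M (fun t ht => (hσ t ht).posSemidef) (hσ s hs)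
    (fun i k => hσc i k s hs) hx'

lemma deriv_right_nonneg {f : ℝ → ℝ} {f' : ℝ} (hf : HasDerivWithinAt f f' (Set.Ici 0) 0)
    (h0 : ∀ t, 0 ≤ t → f 0 ≤ f t) : 0 ≤ f' := by
  rw [hasDerivWithinAt_iff_tendsto_slope, Set.Ici_sdiff_left] at hf
  refine ge_of_tendsto hf ?_
  filter_upwards [self_mem_nhdsWithin] with t ht
  rw [slope_def_field]
  exact div_nonneg (sub_nonneg.2 (h0 t (le_of_lt ht))) (sub_nonneg.2 (le_of_lt ht))

/-- The differential inequality obtained from the gradient estimate at `t = 0`. -/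
lemma GE'.differential {Q : QMS ι} {v : J → Mat ι} {M : OperatorMean ι} {K ν : ℝ}
    (hGE : GE' Q.P Q.gen v M K ν) {ρ : Mat ι} (hρ : ρ.PosDef) (hρ1 : trn ρ = 1) {D : Op ι}
    (hD : ∀ a b : Mat ι, HasDerivWithinAt (fun t : ℝ => inn (rhoHat M (Q.P t ρ) a) b)
      (inn (D a) b) (Set.Ici 0) 0) (a : Mat ι) :
    K * dNormSq M v ρ a + ν * Complex.normSq (inn a (Q.gen ρ)) ≤
      (∑ j, inn (rhoHat M ρ (comm (v j) (Q.gen a))) (comm (v j) a)).re +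
        2⁻¹ * (∑ j, inn (D (comm (v j) a)) (comm (v j) a)).re := by
  have hP0 : ∀ x, Q.P 0 x = x := fun x => by rw [Q.P_zero]; rfl
  have hL : HasDerivWithinAt (fun t => dNormSq M v ρ (Q.P t a))
      (-(2 * (∑ j, inn (rhoHat M ρ (comm (v j) (Q.gen a))) (comm (v j) a)).re))
      (Set.Ici 0) 0 := by
    refine (hasDerivWithinAt_dNormSq M v (σ := fun _ => ρ) (x := fun t => Q.P t a)
      (x' := -Q.gen a) (T' := 0) hρ.posSemidef
      (fun b c => (hasDerivWithinAt_const _ _ _).congr_deriv (by simp [inn, trn]))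
      (fun i j => Q.P_deriv a i j)).congr_deriv ?_
    simp [hP0, comm_neg, inn, trn]
  have hR : HasDerivWithinAt (fun t => dNormSq M v (Q.P t ρ) a)
      (∑ j, inn (D (comm (v j) a)) (comm (v j) a)).re (Set.Ici 0) 0 := by
    refine (hasDerivWithinAt_dNormSq M v (σ := fun t => Q.P t ρ) (x := fun _ => a)
      (x' := 0) (T' := D) (by simpa only [hP0] using hρ.posSemidef) hD
      (fun i j => hasDerivAt_const _ _)).congr_deriv ?_
    simp [comm_zero, inn, trn]
  have hE : ContinuousWithinAt (fun t => Complex.normSq (inn a (Q.gen (Q.P t ρ))))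
      (Set.Ici 0) 0 :=
    Complex.continuous_normSq.continuousAt.comp_continuousWithinAt
      (hasDerivAt_linear (fun i j => Q.P_deriv ρ i j)
        (innRight a ∘ₗ Q.gen)).continuousAt.continuousWithinAt
  have hN : HasDerivWithinAt (fun t => ν * cK K t * Complex.normSq (inn a (Q.gen (Q.P t ρ))))
      (2 * ν * Complex.normSq (inn a (Q.gen ρ))) (Set.Ici 0) 0 := by
    have hc : HasDerivWithinAt (cK K) 2 (Set.Ici 0) 0 := by
      simpa using (hasDerivAt_cK K 0).hasDerivWithinAt
    rw [hasDerivWithinAt_iff_tendsto_slope] at hc ⊢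
    have h := (hc.mul (hE.mono_left (nhdsWithin_mono _ Set.sdiff_subset))).const_mul ν
    simp only [hP0] at h
    convert h using 1
    · ext t
      simp only [slope_def_field, cK_zero]
      ring
    · ring_nf
  have hnn := deriv_right_nonneg
    ((((hasDerivAt_exp_neg K 0).hasDerivWithinAt.mul hR).sub hN).sub hL) fun t ht => by
      have := hGE t ht a ρ hρ hρ1
      simpa [hP0, cK_zero] using this
  simp only [hP0, mul_zero, neg_zero, Real.exp_zero] at hnn
  linarith

/-- The gradient estimate obtained by integrating the differential inequality along
`s ↦ e^{-2Ks}‖∂P_{t-s}a‖²_{P_sρ}`. -/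
lemma GE'.of_differential {Q : QMS ι} (hsymm : TraciallySymm Q) {v : J → Mat ι}
    {M : OperatorMean ι} {K ν : ℝ} {D : Mat ι → Op ι}
    (hD : ∀ ρ : Mat ι, ρ.PosDef → trn ρ = 1 → ∀ a b : Mat ι,
      HasDerivWithinAt (fun t : ℝ => inn (rhoHat M (Q.P t ρ) a) b)
        (inn (D ρ a) b) (Set.Ici 0) 0)
    (hdiff : ∀ ρ a : Mat ι, ρ.PosDef → trn ρ = 1 →
      K * dNormSq M v ρ a + ν * Complex.normSq (inn a (Q.gen ρ)) ≤
        (∑ j, inn (rhoHat M ρ (comm (v j) (Q.gen a))) (comm (v j) a)).re +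
          2⁻¹ * (∑ j, inn (D ρ (comm (v j) a)) (comm (v j) a)).re) :
    GE' Q.P Q.gen v M K ν := by
  intro t ht a ρ hρ hρ1
  have hP0 : ∀ x, Q.P 0 x = x := fun x => by rw [Q.P_zero]; rfl
  set C : ℝ := Complex.normSq (inn a (Q.gen (Q.P t ρ))) with hC
  set σ : ℝ → Mat ι := fun s => Q.P s ρ with hσ
  set b : ℝ → Mat ι := fun s => Q.P (t - s) a with hb
  have hb' : ∀ s i j, HasDerivAt (fun s => b s i j) (Q.gen (b s) i j) s := by
    intro s i j
    have h := HasDerivAt.comp_const_sub t s (Q.hasDerivAt_P a (t - s) i j)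
    rwa [neg_neg, Q.P_gen] at h
  have hσpos : ∀ s, 0 ≤ s → (σ s).PosDef := fun s hs => Q.posDef_P hs hρ
  have hσD : ∀ s, 0 ≤ s → ∀ x y, HasDerivWithinAt (fun u => inn (rhoHat M (σ u) x) y)
      (inn (D (σ s) x) y) (Set.Ici s) s := by
    intro s hs x y
    have h := hD (σ s) (hσpos s hs) ((QMS.trn_P hsymm hs ρ).trans hρ1) x y
    simp only [hσ, ← Q.P_add_apply] at h
    rw [← sub_self s] at h
    have h' := h.scomp s (h := fun u => u - s) ((hasDerivAt_id s).sub_const s).hasDerivWithinAt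
      (s := Set.Ici s) fun u hu => by simpa using hu
    simpa [Function.comp_def] using h'
  have hF : ∀ s, 0 ≤ s → HasDerivWithinAt
      (fun s => Real.exp (-(2 * K * s)) * dNormSq M v (σ s) (b s)) _ (Set.Ici s) s :=
    fun s hs => (hasDerivAt_exp_neg K s).hasDerivWithinAt.mul
      (hasDerivWithinAt_dNormSq M v (hσpos s hs).posSemidef (hσD s hs) (hb' s))
  have hFc : ContinuousOn (fun s => Real.exp (-(2 * K * s)) * dNormSq M v (σ s) (b s))
      (Set.Icc 0 t) := by
    refine ContinuousOn.mul (by fun_prop) (continuousOn_dNormSq M v (fun s hs => hσpos s hs.1)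
      (fun i j => (Q.P_cont ρ i j).continuousOn) fun i j s _ =>
        (hb' s i j).continuousAt.continuousWithinAt)
  have hG : ∀ s, HasDerivAt (fun s => dNormSq M v ρ (Q.P t a) + ν * C * cK K s)
      (ν * C * (2 * Real.exp (-(2 * K * s)))) s :=
    fun s => ((hasDerivAt_cK K s).const_mul _).const_add _
  have key := image_le_of_deriv_right_le_deriv_boundary (a := 0) (b := t)
    (fun s _ => (hG s).continuousAt.continuousWithinAt)
    (fun s _ => (hG s).hasDerivWithinAt) (by simp [hσ, hb, hP0, cK_zero]) hFc
    (fun s hs => hF s hs.1) (fun s hs => by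
      have hE : inn (b s) (Q.gen (σ s)) = inn a (Q.gen (Q.P t ρ)) := by
        rw [hb, QMS.inn_P hsymm (sub_nonneg.2 hs.2.le), Q.P_gen, hσ, ← Q.P_add_apply,
          sub_add_cancel]
      have h := hdiff (σ s) (b s) (hσpos s hs.1) ((QMS.trn_P hsymm hs.1 ρ).trans hρ1)
      rw [hE, ← hC] at h
      have h2 := mul_le_mul_of_nonneg_left h (Real.exp_pos (-(2 * K * s))).le
      linarith) (Set.right_mem_Icc.2 ht)
  simp only [hσ, hb, sub_self, hP0] at key
  linarith

end GradientEstimate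

/-- For a tracially symmetric quantum Markov semigroup with Lindblad
form and any operator mean, assuming differentiability at `t = 0` of `t ↦ \widehat{P_tρ}`
(with derivative `D ρ`), the gradient estimate `GE(K,N)` is equivalent to the
differential inequality
`Re ∑ⱼ⟨ρ̂ ∂ⱼ(La), ∂ⱼa⟩ + ½ (d/dt)|₀ ∑ⱼ⟨\widehat{P_tρ} ∂ⱼa, ∂ⱼa⟩ ≥ K‖∂a‖²_ρ + (1/N)|E(a,ρ)|²`. -/
theorem GE_iff_differential {n d : ℕ} (Q : QMS (Fin n)) (hsymm : TraciallySymm Q)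
    (v : Fin d → Mat (Fin n)) (hLind : LindbladForm Q.gen v)
    (M : OperatorMean (Fin n)) (K : ℝ) (N : ℝ≥0∞) (hN : 0 < N)
    (D : Mat (Fin n) → Op (Fin n))
    (hD : ∀ ρ : Mat (Fin n), ρ.PosDef → trn ρ = 1 → ∀ a b : Mat (Fin n),
      HasDerivWithinAt (fun t : ℝ => inn (rhoHat M (Q.P t ρ) a) b)
        (inn (D ρ a) b) (Set.Ici 0) 0) :
    GE' Q.P Q.gen v M K N⁻¹.toReal ↔
      ∀ ρ a : Mat (Fin n), ρ.PosDef → trn ρ = 1 →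
        K * dNormSq M v ρ a + N⁻¹.toReal * Complex.normSq (inn a (Q.gen ρ)) ≤
          (∑ j, inn (rhoHat M ρ (comm (v j) (Q.gen a))) (comm (v j) a)).re +
            2⁻¹ * (∑ j, inn (D ρ (comm (v j) a)) (comm (v j) a)).re := by
  exact ⟨fun h ρ a hρ hρ1 => h.differential hρ hρ1 (hD ρ hρ hρ1) a,
    GE'.of_differential hsymm hD⟩

end CD
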